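/- For every δ > 0 there exists n_δ < ∞ such that for all n ≥ n_δ, the mean of the n-step distribution started at 0 satisfies ∑_{x∈ℤ} Pⁿ(0,x)·x ≤ −1/(2+δ). -/

import Mathlib

open MeasureTheory Filter
open scoped BigOperators ENNReal

noncomputable section

/-- `p(x) = w(-x)/(w(x)+w(-x))`. -/
def pfun (w : ℤ → ℝ) (x : ℤ) : ℝ := w (-x) / (w x + w (-x))

/-- `q(x) = w(x)/(w(x)+w(-x))`. -/
def qfun (w : ℤ → ℝ) (x : ℤ) : ℝ := w x / (w x + w (-x))

/-- The Markov transition kernel `P(x,y)`. -/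
def Pker (w : ℤ → ℝ) (x y : ℤ) : ℝ :=
  if x - 1 ≤ y then (∏ z ∈ Finset.Icc x y, pfun w z) * qfun w (y + 1) else 0

/-- The `m`-step transition kernel. -/
def Pm (w : ℤ → ℝ) : ℕ → ℤ → ℤ → ℝ
  | 0, x, y => if x = y then 1 else 0
  | m + 1, x, y => ∑' z : ℤ, Pm w m x z * Pker w z y

/-- The normalizing constant `Z`. -/
def Zconst (w : ℤ → ℝ) : ℝ :=
  2 * ∑' x : ℕ, ∏ z ∈ Finset.Icc (1 : ℤ) (x : ℤ), w (-z) / w z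

/-- The stationary distribution `ρ`. -/
def rho (w : ℤ → ℝ) (x : ℤ) : ℝ :=
  (Zconst w)⁻¹ * ∏ z ∈ Finset.Icc (1 : ℤ) (|2 * x + 1| / 2), w (-z) / w z

/-- The weight function `w` is positive, nondecreasing and satisfies
`lim_{z→∞} (w(z) - w(-z)) > 0`. -/
def GoodWeight (w : ℤ → ℝ) : Prop :=
  (∀ z, 0 < w z) ∧ (∀ z, w z ≤ w (z + 1)) ∧
    ∃ c > (0 : ℝ), ∀ᶠ z : ℤ in atTop, c ≤ w z - w (-z)

/-- `η` is a Markov chain with (sub)stochastic kernel `K` started at `a`,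
characterized through its cylinder probabilities. -/
def KChain {Ω : Type*} [MeasurableSpace Ω] (μ : Measure Ω)
    (K : ℤ → ℤ → ℝ) (η : ℕ → Ω → ℤ) (a : ℤ) : Prop :=
  (∀ n, Measurable (η n)) ∧
  ∀ (n : ℕ) (x : ℕ → ℤ),
    μ {ω | ∀ i ≤ n, η i ω = x i} =
      ENNReal.ofReal ((if x 0 = a then (1 : ℝ) else 0) *
        ∏ i ∈ Finset.range n, K (x i) (x (i + 1)))

section Convergence

variable {ι : Type*}

/-- Pushing an absolutely summable signed measure forward by a nonnegative kernel with bounded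
row sums: the total mass is preserved up to row sums, and the total variation is controlled. -/
lemma kernel_push {K : ι → ι → ℝ} (hK : ∀ x y, 0 ≤ K x y) {s : ι → ℝ}
    (hs : ∀ x, HasSum (K x) (s x)) (hs1 : ∀ x, s x ≤ 1) {ν : ι → ℝ} (hν : Summable ν) :
    Summable (fun y => ∑' x, ν x * K x y) ∧ (∀ y, Summable fun x => ν x * K x y) ∧
      ∑' y, ∑' x, ν x * K x y = ∑' x, ν x * s x ∧
      ∑' y, |∑' x, ν x * K x y| ≤ ∑' x, |ν x| * s x := by
  have hs0 : ∀ x, 0 ≤ s x := fun x => (hs x).nonneg (hK x)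
  have habs : Summable fun p : ι × ι => |ν p.1| * K p.1 p.2 := by
    have h0 : ∀ p : ι × ι, 0 ≤ |ν p.1| * K p.1 p.2 := fun p =>
      mul_nonneg (abs_nonneg _) (hK _ _)
    refine (summable_prod_of_nonneg h0).2 ⟨fun x => (hs x).summable.mul_left |ν x|, ?_⟩
    simp only [tsum_mul_left, (hs _).tsum_eq]
    exact Summable.of_nonneg_of_le (fun x => mul_nonneg (abs_nonneg _) (hs0 x))
      (fun x => mul_le_of_le_one_right (abs_nonneg _) (hs1 x)) hν.abs
  have heq : ∀ x y, |ν x * K x y| = |ν x| * K x y := fun x y => by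
    rw [abs_mul, abs_of_nonneg (hK x y)]
  have hprod : Summable fun p : ι × ι => ν p.1 * K p.1 p.2 :=
    Summable.of_abs (by simpa only [heq] using habs)
  have hcol : ∀ y, Summable fun x => |ν x| * K x y := fun y => habs.prod_symm.prod_factor y
  have hcolsum : Summable fun y => ∑' x, |ν x| * K x y := habs.prod_symm.prod
  have hle : ∀ y, |∑' x, ν x * K x y| ≤ ∑' x, |ν x| * K x y := fun y => by
    have h := norm_tsum_le_tsum_norm (f := fun x => ν x * K x y)
      (by simpa only [Real.norm_eq_abs, heq] using hcol y)
    simpa only [Real.norm_eq_abs, heq] using h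
  refine ⟨hprod.prod_symm.prod, fun y => hprod.prod_symm.prod_factor y, ?_, ?_⟩
  · rw [Summable.tsum_comm (f := fun x y => ν x * K x y) hprod]
    simp only [tsum_mul_left, (hs _).tsum_eq]
  · calc ∑' y, |∑' x, ν x * K x y| ≤ ∑' y, ∑' x, |ν x| * K x y :=
          Summable.tsum_le_tsum hle
            (Summable.of_nonneg_of_le (fun y => abs_nonneg _) hle hcolsum) hcolsum
      _ = ∑' x, |ν x| * s x := by
          rw [Summable.tsum_comm (f := fun x y => |ν x| * K x y) habs]
          simp only [tsum_mul_left, (hs _).tsum_eq]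

/-- One step of a chain for which all points of `A` jump to `y₀` with probability at least `κ`
contracts the total variation of a signed measure of total mass zero, up to the mass
outside of `A`. -/
lemma doeblin_step {K : ι → ι → ℝ} (hK : ∀ x y, 0 ≤ K x y) (hK1 : ∀ x, HasSum (K x) 1)
    {ν : ι → ℝ} (hν : Summable ν) (hν0 : ∑' x, ν x = 0) {A : Finset ι} {ε κ : ℝ}
    (hκ : 0 ≤ κ) {y₀ : ι} (hA : ∀ x ∈ A, κ ≤ K x y₀) (hε : ∑' x, |ν x| - ∑ x ∈ A, |ν x| ≤ ε) :
    ∑' y, |∑' x, ν x * K x y| ≤ (1 - κ) * ∑' x, |ν x| + 2 * κ * ε := by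
  classical
  set J : ι → ι → ℝ := fun x y => if x ∈ A then (if y = y₀ then κ else 0) else 0 with hJ
  set a : ι → ℝ := fun x => if x ∈ A then κ else 0 with ha
  have hJs : ∀ x, HasSum (J x) (a x) := by
    intro x
    by_cases hx : x ∈ A
    · simpa [hJ, ha, hx] using hasSum_ite_eq y₀ κ
    · simp [hJ, ha, hx]
  have hJK : ∀ x y, J x y ≤ K x y := by
    intro x y
    by_cases hx : x ∈ A
    · by_cases hy : y = y₀
      · simpa [hJ, hx, hy] using hA x hx
      · simpa [hJ, hx, hy] using hK x y
    · simpa [hJ, hx] using hK x y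
  have ha0 : ∀ x, 0 ≤ a x := fun x => by simp only [ha]; split_ifs <;> simp [hκ]
  obtain ⟨hsum, hcol, -, hR⟩ := kernel_push (K := fun x y => K x y - J x y)
    (s := fun x => 1 - a x) (fun x y => sub_nonneg.2 (hJK x y)) (fun x => (hK1 x).sub (hJs x))
    (fun x => by linarith [ha0 x]) hν
  have hfin : ∀ f : ι → ℝ, HasSum (fun x => f x * a x) (κ * ∑ x ∈ A, f x) := by
    intro f
    have h : HasSum (fun x => f x * a x) (∑ x ∈ A, f x * a x) :=
      hasSum_sum_of_ne_finset_zero fun x hx => by simp [ha, hx]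
    convert h using 1
    rw [Finset.mul_sum]
    exact Finset.sum_congr rfl fun x hx => by simp [ha, hx, mul_comm]
  set m : ℝ := κ * ∑ x ∈ A, ν x with hm
  have hJν : ∀ y, HasSum (fun x => ν x * J x y) (if y = y₀ then m else 0) := by
    intro y
    by_cases hy : y = y₀
    · simpa [hJ, hy, ha] using hfin ν
    · simp [hJ, hy]
  have hsplit : ∀ y, ∑' x, ν x * K x y
      = ∑' x, ν x * (K x y - J x y) + if y = y₀ then m else 0 := by
    intro y
    rw [← (hJν y).tsum_eq, ← (hcol y).tsum_add (hJν y).summable]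
    exact tsum_congr fun x => by ring
  have hpoint : HasSum (fun y => if y = y₀ then |m| else 0) |m| := hasSum_ite_eq y₀ |m|
  have hle : ∀ y, |∑' x, ν x * K x y|
      ≤ |∑' x, ν x * (K x y - J x y)| + if y = y₀ then |m| else 0 := by
    intro y
    rw [hsplit y]
    refine (abs_add_le _ _).trans (add_le_add le_rfl ?_)
    split_ifs <;> simp
  have hbd := hsum.abs.add hpoint.summable
  have h1 : ∑' y, |∑' x, ν x * K x y|
      ≤ ∑' y, |∑' x, ν x * (K x y - J x y)| + |m| := by
    rw [← hpoint.tsum_eq, ← hsum.abs.tsum_add hpoint.summable]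
    exact Summable.tsum_le_tsum hle
      (Summable.of_nonneg_of_le (fun _ => abs_nonneg _) hle hbd) hbd
  have h2 : ∑' x, |ν x| * (1 - a x) = ∑' x, |ν x| - κ * ∑ x ∈ A, |ν x| := by
    rw [← (hfin fun x => |ν x|).tsum_eq,
      ← hν.abs.tsum_sub (hfin fun x => |ν x|).summable]
    exact tsum_congr fun x => by ring
  have h3 : |∑ x ∈ A, ν x| ≤ ε := by
    refine le_trans ?_ hε
    have e1 := hν.sum_add_tsum_subtype_compl A
    have e2 := hν.abs.sum_add_tsum_subtype_compl A
    have e3 : ∑ x ∈ A, ν x = -∑' x : {x // x ∉ A}, ν x := by linarith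
    have e4 : |∑' x : {x // x ∉ A}, ν x| ≤ ∑' x : {x // x ∉ A}, |ν x| :=
      norm_tsum_le_tsum_norm (f := fun x : {x // x ∉ A} => ν x) (hν.abs.subtype _)
    rw [e3, abs_neg]
    linarith
  have h4 : |m| ≤ κ * ε := by
    rw [hm, abs_mul, abs_of_nonneg hκ]
    exact mul_le_mul_of_nonneg_left h3 hκ
  nlinarith [mul_le_mul_of_nonneg_left hε hκ]

/-- Total variation convergence for a dominated evolution of signed measures of mass zero. -/
lemma tendsto_totalVariation_zero {K : ι → ι → ℝ} (hK : ∀ x y, 0 ≤ K x y)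
    (hK1 : ∀ x, HasSum (K x) 1) (hmeet : ∀ A : Finset ι, ∃ y₀, ∀ x ∈ A, 0 < K x y₀)
    {ν : ℕ → ι → ℝ} (hstep : ∀ n y, ν (n + 1) y = ∑' x, ν n x * K x y)
    {B : ι → ℝ} (hB : Summable B) (hνB : ∀ n x, |ν n x| ≤ B x) (h0 : ∑' x, ν 0 x = 0) :
    Tendsto (fun n => ∑' x, |ν n x|) atTop (nhds 0) := by
  have hν : ∀ n, Summable (ν n) := fun n =>
    Summable.of_abs (Summable.of_nonneg_of_le (fun _ => abs_nonneg _) (hνB n) hB)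
  have hmass : ∀ n, ∑' x, ν n x = 0 := by
    intro n
    induction n with
    | zero => exact h0
    | succ n ih =>
      have h := (kernel_push hK hK1 (fun _ => le_rfl) (hν n)).2.2.1
      simp only [← hstep, mul_one] at h
      rw [h, ih]
  rw [Metric.tendsto_atTop]
  intro η hη
  set ε := η / 3 with hε
  have hεpos : 0 < ε := by positivity
  obtain ⟨A, hA⟩ := ((tendsto_order.1 hB.hasSum).1 (∑' x, B x - ε) (by linarith)).exists
  obtain ⟨y₀, hy₀⟩ := hmeet A
  obtain ⟨κ, hκ0, hκ1, hκ⟩ : ∃ κ : ℝ, 0 < κ ∧ κ ≤ 1 ∧ ∀ x ∈ A, κ ≤ K x y₀ := by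
    classical
    clear hA
    induction A using Finset.induction_on with
    | empty => exact ⟨1, one_pos, le_rfl, by simp⟩
    | insert x A hx ih =>
      obtain ⟨κ, h0, h1, h⟩ := ih fun z hz => hy₀ z (Finset.mem_insert_of_mem hz)
      refine ⟨min κ (K x y₀), lt_min h0 (hy₀ x (Finset.mem_insert_self _ _)),
        (min_le_left _ _).trans h1, fun z hz => ?_⟩
      rcases Finset.mem_insert.1 hz with rfl | hz
      · exact min_le_right _ _
      · exact (min_le_left _ _).trans (h z hz)
  have htail : ∀ n, ∑' x, |ν n x| - ∑ x ∈ A, |ν n x| ≤ ε := by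
    intro n
    have e1 := (hν n).abs.sum_add_tsum_subtype_compl A
    have e2 := hB.sum_add_tsum_subtype_compl A
    have e3 : ∑' x : {x // x ∉ A}, |ν n x| ≤ ∑' x : {x // x ∉ A}, B x :=
      Summable.tsum_le_tsum (fun x => hνB n x) ((hν n).abs.subtype _) (hB.subtype _)
    linarith
  set D : ℕ → ℝ := fun n => ∑' x, |ν n x| with hD
  have hrec : ∀ n, D (n + 1) ≤ (1 - κ) * D n + 2 * κ * ε := by
    intro n
    have h := doeblin_step hK hK1 (hν n) (hmass n) hκ0.le hκ (htail n)
    simpa only [hD, hstep n] using h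
  have hgeo : ∀ n, D n - 2 * ε ≤ (1 - κ) ^ n * D 0 := by
    intro n
    induction n with
    | zero => simp; exact hεpos.le
    | succ n ih =>
      have := mul_le_mul_of_nonneg_left ih (sub_nonneg.2 hκ1)
      rw [pow_succ']
      linarith [hrec n]
  have hlim : Tendsto (fun n => (1 - κ) ^ n * D 0) atTop (nhds 0) := by
    simpa using (tendsto_pow_atTop_nhds_zero_of_lt_one (sub_nonneg.2 hκ1)
      (by linarith)).mul_const (D 0)
  obtain ⟨N, hN⟩ := eventually_atTop.1 ((tendsto_order.1 hlim).2 ε hεpos)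
  refine ⟨N, fun n hn => ?_⟩
  have hDn : 0 ≤ D n := tsum_nonneg fun _ => abs_nonneg _
  rw [Real.dist_eq, sub_zero, abs_of_nonneg hDn]
  linarith [hgeo n, hN n hn]

end Convergence

section Invariant

variable {w : ℤ → ℝ}

/-- The invariant density on `ℕ`, normalized to be `1` at `0`. -/
def invNat (w : ℤ → ℝ) (n : ℕ) : ℝ :=
  ∏ k ∈ Finset.range n, w (-((k : ℤ) + 1)) / w ((k : ℤ) + 1)

/-- The invariant density on `ℤ`, normalized to be `1` at `0`; it is symmetric about `-1/2`. -/
def invDensity (w : ℤ → ℝ) : ℤ → ℝ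
  | Int.ofNat n => invNat w n
  | Int.negSucc n => invNat w n

lemma invDensity_pos (hw : ∀ z, 0 < w z) (x : ℤ) : 0 < invDensity w x := by
  have h : ∀ n, 0 < invNat w n := fun n => Finset.prod_pos fun k _ => div_pos (hw _) (hw _)
  cases x <;> exact h _

lemma invDensity_zero : invDensity w 0 = 1 :=
  show invNat w 0 = 1 by simp [invNat]

lemma invDensity_reflect (x : ℤ) : invDensity w (-1 - x) = invDensity w x := by
  cases x with
  | ofNat n =>
    rw [show (-1 - Int.ofNat n : ℤ) = Int.negSucc n by simp; omega]
    rfl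
  | negSucc n =>
    rw [show (-1 - Int.negSucc n : ℤ) = Int.ofNat n by simp; omega]
    rfl

/-- The detailed-balance type recursion for the invariant density. -/
lemma invDensity_mul (hw : ∀ z, 0 < w z) (y : ℤ) :
    invDensity w y * w y = invDensity w (y - 1) * w (-y) := by
  have hsucc : ∀ n : ℕ, invNat w (n + 1) * w ((n : ℤ) + 1)
      = invNat w n * w (-((n : ℤ) + 1)) := by
    intro n
    rw [invNat, Finset.prod_range_succ, mul_assoc, div_mul_cancel₀ _ (hw _).ne']
    rfl
  rcases lt_trichotomy y 0 with hy | rfl | hy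
  · obtain ⟨n, rfl⟩ : ∃ n : ℕ, y = Int.negSucc n := ⟨(-y - 1).toNat, by omega⟩
    have h := hsucc n
    rw [show (Int.negSucc n - 1 : ℤ) = Int.negSucc (n + 1) by omega]
    change invNat w n * w (Int.negSucc n) = invNat w (n + 1) * w (-Int.negSucc n)
    rw [show (-Int.negSucc n : ℤ) = (n : ℤ) + 1 by omega, h]
    congr 2
  · have h : invDensity w (0 - 1) = invDensity w 0 := by
      simpa using invDensity_reflect (w := w) 0
    rw [h, neg_zero]
  · obtain ⟨n, rfl⟩ : ∃ n : ℕ, y = (n : ℤ) + 1 := ⟨(y - 1).toNat, by omega⟩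
    rw [add_sub_cancel_right]
    exact hsucc n

lemma pfun_pos (hw : ∀ z, 0 < w z) (x : ℤ) : 0 < pfun w x :=
  div_pos (hw _) (add_pos (hw _) (hw _))

lemma qfun_pos (hw : ∀ z, 0 < w z) (x : ℤ) : 0 < qfun w x :=
  div_pos (hw _) (add_pos (hw _) (hw _))

lemma pfun_add_qfun (hw : ∀ z, 0 < w z) (x : ℤ) : pfun w x + qfun w x = 1 := by
  rw [pfun, qfun, ← add_div, add_comm, div_self (add_pos (hw _) (hw _)).ne']

lemma pfun_le_one (hw : ∀ z, 0 < w z) (x : ℤ) : pfun w x ≤ 1 := by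
  linarith [pfun_add_qfun hw x, qfun_pos hw x]

lemma qfun_mul_invDensity_add (hw : ∀ z, 0 < w z) (y : ℤ) :
    (invDensity w (y - 1) + invDensity w y) * qfun w y = invDensity w (y - 1) := by
  have h := invDensity_mul hw y
  rw [qfun, mul_div_assoc', div_eq_iff (add_pos (hw _) (hw _)).ne']
  linarith

lemma pfun_mul_invDensity_add (hw : ∀ z, 0 < w z) (y : ℤ) :
    (invDensity w (y - 1) + invDensity w y) * pfun w y = invDensity w y := by
  have h := qfun_mul_invDensity_add hw y
  rw [show pfun w y = 1 - qfun w y by linarith [pfun_add_qfun hw y]]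
  linarith

lemma summable_succ_mul_invNat (hw : GoodWeight w) :
    Summable fun n : ℕ => ((n : ℝ) + 1) * invNat w n := by
  obtain ⟨hpos, hmono, c, hc, hev⟩ := hw
  have hmono' : Monotone w := monotone_int_of_le_succ hmono
  set a := w 0 / (w 0 + c) with ha
  have hac : 0 < w 0 + c := add_pos (hpos 0) hc
  have ha1 : a < 1 := by rw [ha, div_lt_one hac]; linarith
  have ha0 : 0 < a := div_pos (hpos 0) hac
  have hpn : ∀ n, 0 < invNat w n := fun n =>
    Finset.prod_pos fun k _ => div_pos (hpos _) (hpos _)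
  have hratio : ∀ᶠ n : ℕ in atTop, w (-((n : ℤ) + 1)) / w ((n : ℤ) + 1) ≤ a := by
    have ht : Tendsto (fun n : ℕ => (n : ℤ) + 1) atTop atTop :=
      tendsto_atTop_add_const_right _ _ tendsto_natCast_atTop_atTop
    filter_upwards [ht.eventually hev] with n hn
    have h0 : w (-((n : ℤ) + 1)) ≤ w 0 := hmono' (by omega)
    rw [ha, div_le_div_iff₀ (hpos _) hac]
    nlinarith [hpos 0, hpos (-((n : ℤ) + 1))]
  have hlarge : ∀ᶠ n : ℕ in atTop, 2 * a / (1 - a) ≤ (n : ℝ) :=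
    tendsto_natCast_atTop_atTop.eventually_ge_atTop _
  refine summable_of_ratio_norm_eventually_le (r := (1 + a) / 2) (by linarith) ?_
  filter_upwards [hratio, hlarge] with n hn hl
  rw [div_le_iff₀ (by linarith)] at hl
  have hn0 : (0 : ℝ) ≤ n := n.cast_nonneg
  rw [Real.norm_of_nonneg (mul_nonneg (by positivity) (hpn _).le),
    Real.norm_of_nonneg (mul_nonneg (by positivity) (hpn _).le),
    show invNat w (n + 1) = invNat w n * (w (-((n : ℤ) + 1)) / w ((n : ℤ) + 1)) from
      Finset.prod_range_succ _ _]
  push_cast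
  calc ((n : ℝ) + 1 + 1) * (invNat w n * (w (-((n : ℤ) + 1)) / w ((n : ℤ) + 1)))
      ≤ ((n : ℝ) + 1 + 1) * (invNat w n * a) := by
        have := (hpn n).le
        gcongr
    _ = (((n : ℝ) + 1 + 1) * a) * invNat w n := by ring
    _ ≤ ((1 + a) / 2 * ((n : ℝ) + 1)) * invNat w n :=
        mul_le_mul_of_nonneg_right (by nlinarith) (hpn n).le
    _ = (1 + a) / 2 * (((n : ℝ) + 1) * invNat w n) := by ring

lemma summable_abs_add_one_mul_invDensity (hw : GoodWeight w) :
    Summable fun x : ℤ => (|(x : ℝ)| + 1) * invDensity w x := by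
  have h := summable_succ_mul_invNat hw
  have hpos : ∀ n, 0 < invNat w n := fun n => invDensity_pos hw.1 (Int.ofNat n)
  refine Summable.of_nat_of_neg_add_one ?_ ?_
  · refine h.congr fun n => ?_
    rw [Int.cast_natCast, abs_of_nonneg n.cast_nonneg]
    rfl
  · refine Summable.of_nonneg_of_le (fun n => ?_) (fun n => ?_) (h.mul_left 2)
    · exact mul_nonneg (by positivity) (invDensity_pos hw.1 _).le
    · rw [show (-((n : ℤ) + 1)) = Int.negSucc n by omega]
      change _ * invNat w n ≤ _
      rw [Int.cast_negSucc, abs_neg, abs_of_nonneg (by positivity)]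
      push_cast
      nlinarith [hpos n, mul_nonneg (n.cast_nonneg (α := ℝ)) (hpos n).le]

lemma summable_invDensity (hw : GoodWeight w) : Summable (invDensity w) :=
  Summable.of_nonneg_of_le (fun x => (invDensity_pos hw.1 x).le)
    (fun x => le_mul_of_one_le_left (invDensity_pos hw.1 x).le (by linarith [abs_nonneg (x : ℝ)]))
    (summable_abs_add_one_mul_invDensity hw)

lemma summable_abs_mul_invDensity (hw : GoodWeight w) :
    Summable fun x : ℤ => |(x : ℝ)| * invDensity w x :=
  Summable.of_nonneg_of_le (fun x => mul_nonneg (abs_nonneg _) (invDensity_pos hw.1 x).le)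
    (fun x => mul_le_mul_of_nonneg_right (by linarith) (invDensity_pos hw.1 x).le)
    (summable_abs_add_one_mul_invDensity hw)

lemma tsum_invDensity_mul (hw : GoodWeight w) :
    ∑' x : ℤ, invDensity w x * x = -(1 / 2) * ∑' x, invDensity w x := by
  have h1 : Summable fun x : ℤ => invDensity w x * x := by
    refine Summable.of_abs ((summable_abs_mul_invDensity hw).congr fun x => ?_)
    rw [abs_mul, abs_of_pos (invDensity_pos hw.1 x), mul_comm]
  have h2 := (Equiv.subLeft (-1 : ℤ)).tsum_eq fun x : ℤ => invDensity w x * x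
  have h3 : ∑' x : ℤ, invDensity w x * x
      = ∑' x, -invDensity w x - ∑' x : ℤ, invDensity w x * x := by
    rw [← (summable_invDensity hw).neg.tsum_sub h1, ← h2]
    refine tsum_congr fun x => ?_
    rw [Equiv.subLeft_apply, invDensity_reflect]
    push_cast
    ring
  rw [tsum_neg] at h3
  linarith

lemma Pker_nonneg (hw : ∀ z, 0 < w z) (x y : ℤ) : 0 ≤ Pker w x y := by
  rw [Pker]
  split_ifs
  · exact mul_nonneg (Finset.prod_nonneg fun z _ => (pfun_pos hw z).le) (qfun_pos hw _).le
  · exact le_rfl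

lemma Pker_pos (hw : ∀ z, 0 < w z) {x y : ℤ} (h : x - 1 ≤ y) : 0 < Pker w x y := by
  rw [Pker, if_pos h]
  exact mul_pos (Finset.prod_pos fun z _ => pfun_pos hw z) (qfun_pos hw _)

/-- `invDensity` tends to zero along any injective sequence. -/
lemma tendsto_invDensity (hw : GoodWeight w) {g : ℕ → ℤ} (hg : Function.Injective g) :
    Tendsto (fun k => invDensity w (g k)) atTop (nhds 0) :=
  ((summable_invDensity hw).comp_injective hg).tendsto_atTop_zero

lemma hasSum_of_telescope {f T : ℕ → ℝ} {a : ℝ} (hf : ∀ k, 0 ≤ f k)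
    (h : ∀ k, T k = f k + T (k + 1)) (hT : Tendsto T atTop (nhds 0)) (ha : T 0 = a) :
    HasSum f a := by
  rw [hasSum_iff_tendsto_nat_of_nonneg hf]
  have hs : ∀ n, ∑ i ∈ Finset.range n, f i = a - T n := by
    intro n
    induction n with
    | zero => simp [ha]
    | succ n ih => rw [Finset.sum_range_succ, ih, h n]; ring
  simpa only [hs, sub_zero] using hT.const_sub a

lemma prod_pfun_le (hw : ∀ z, 0 < w z) (x : ℤ) (k : ℕ) :
    (∏ z ∈ Finset.Icc x (x + k - 1), pfun w z) * invDensity w (x - 1)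
      ≤ invDensity w (x + k - 1) := by
  induction k with
  | zero => simp
  | succ k ih =>
    rw [show x + ((k + 1 : ℕ) : ℤ) - 1 = x + k by push_cast; ring,
      ← Finset.insert_Icc_sub_one_right_eq_Icc (show x ≤ x + k by omega),
      Finset.prod_insert (by simp)]
    have h := pfun_mul_invDensity_add hw (x + k)
    have hp := pfun_pos hw (x + k)
    nlinarith [mul_le_mul_of_nonneg_left ih hp.le, mul_pos (invDensity_pos hw (x + k)) hp]

lemma hasSum_Pker_row (hw : GoodWeight w) (x : ℤ) : HasSum (Pker w x) 1 := by
  set g : ℕ → ℤ := fun k => x + k - 1 with hg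
  have hinj : Function.Injective g := fun a b h => by simp only [hg] at h; omega
  have hsupp : ∀ y ∉ Set.range g, Pker w x y = 0 := by
    intro y hy
    rw [Pker, if_neg]
    exact fun h => hy ⟨(y - x + 1).toNat, by simp only [hg]; omega⟩
  rw [← hinj.hasSum_iff hsupp]
  refine hasSum_of_telescope (T := fun k => ∏ z ∈ Finset.Icc x (g k), pfun w z)
    (fun k => Pker_nonneg hw.1 _ _) (fun k => ?_) ?_ (by simp [hg])
  · have h1 : g (k + 1) = x + k := by simp only [hg]; push_cast; ring
    have h2 : g k + 1 = x + k := by simp only [hg]; ring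
    have h3 : g k = x + k - 1 := rfl
    simp only [Function.comp, Pker]
    rw [if_pos (by omega), h1, h2,
      ← Finset.insert_Icc_sub_one_right_eq_Icc (show x ≤ x + k by omega),
      Finset.prod_insert (by simp), h3]
    linear_combination -(∏ z ∈ Finset.Icc x (x + k - 1), pfun w z) * pfun_add_qfun hw.1 (x + k)
  · refine squeeze_zero (fun k => Finset.prod_nonneg fun z _ => (pfun_pos hw.1 z).le)
      (g := fun k => invDensity w (g k) / invDensity w (x - 1)) (fun k => ?_) ?_
    · rw [le_div_iff₀ (invDensity_pos hw.1 _)]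
      exact prod_pfun_le hw.1 x k
    · simpa using (tendsto_invDensity hw hinj).div_const (invDensity w (x - 1))

/-- The density `invDensity` is invariant under the kernel. -/
lemma hasSum_invDensity_mul_Pker (hw : GoodWeight w) (y : ℤ) :
    HasSum (fun x => invDensity w x * Pker w x y) (invDensity w y) := by
  set g : ℕ → ℤ := fun k => y + 1 - k with hg
  have hinj : Function.Injective g := fun a b h => by simp only [hg] at h; omega
  have hsupp : ∀ x ∉ Set.range g, invDensity w x * Pker w x y = 0 := by
    intro x hx
    rw [Pker, if_neg, mul_zero]
    exact fun h => hx ⟨(y + 1 - x).toNat, by simp only [hg]; omega⟩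
  rw [← hinj.hasSum_iff hsupp]
  set T : ℕ → ℝ := fun k => (∏ z ∈ Finset.Icc (g k) y, pfun w z) *
    (invDensity w (g k - 1) + invDensity w (g k)) * qfun w (y + 1) with hT
  refine hasSum_of_telescope (T := T)
    (fun k => mul_nonneg (invDensity_pos hw.1 _).le (Pker_nonneg hw.1 _ _)) (fun k => ?_) ?_ ?_
  · have h1 : g (k + 1) = g k - 1 := by simp only [hg]; push_cast; ring
    have h2 : g k - 1 ≤ y := by simp only [hg]; omega
    have h3 : Finset.Icc (g k - 1) y = insert (g k - 1) (Finset.Icc (g k) y) := by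
      ext z; simp only [Finset.mem_Icc, Finset.mem_insert]; omega
    have h4 := pfun_mul_invDensity_add hw.1 (g k - 1)
    simp only [hT, Function.comp, Pker]
    rw [if_pos h2, h1, h3, Finset.prod_insert (by simp)]
    linear_combination (-(∏ z ∈ Finset.Icc (g k) y, pfun w z) * qfun w (y + 1)) * h4
  · have hlim : Tendsto (fun k => invDensity w (g k - 1) + invDensity w (g k)) atTop (nhds 0) := by
      have h := (tendsto_invDensity hw (g := fun k => g k - 1)
        fun a b h => hinj (sub_left_injective h)).add (tendsto_invDensity hw hinj)
      simpa using h
    have hq1 : qfun w (y + 1) ≤ 1 := by linarith [pfun_add_qfun hw.1 (y + 1), pfun_pos hw.1 (y + 1)]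
    have hs : ∀ k, 0 ≤ invDensity w (g k - 1) + invDensity w (g k) := fun k =>
      (add_pos (invDensity_pos hw.1 _) (invDensity_pos hw.1 _)).le
    have hp : ∀ k, 0 ≤ ∏ z ∈ Finset.Icc (g k) y, pfun w z := fun k =>
      Finset.prod_nonneg fun z _ => (pfun_pos hw.1 z).le
    refine squeeze_zero (fun k => ?_) (fun k => ?_) hlim
    · exact mul_nonneg (mul_nonneg (hp k) (hs k)) (qfun_pos hw.1 _).le
    · refine (mul_le_of_le_one_right (mul_nonneg (hp k) (hs k)) hq1).trans ?_
      exact mul_le_of_le_one_left (hs k)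
        (Finset.prod_le_one (fun z _ => (pfun_pos hw.1 z).le) fun z _ => pfun_le_one hw.1 z)
  · have h := qfun_mul_invDensity_add hw.1 (y + 1)
    simp only [hT, hg]
    simpa using h

lemma Pm_nonneg (hw : ∀ z, 0 < w z) (n : ℕ) (x y : ℤ) : 0 ≤ Pm w n x y := by
  induction n generalizing y with
  | zero => rw [Pm]; split_ifs <;> norm_num
  | succ n ih => exact tsum_nonneg fun z => mul_nonneg (ih z) (Pker_nonneg hw z y)

/-- The `n`-step distribution from `0` is dominated by the invariant density. -/
lemma Pm_zero_le_invDensity (hw : GoodWeight w) (n : ℕ) (y : ℤ) :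
    Pm w n 0 y ≤ invDensity w y := by
  induction n generalizing y with
  | zero =>
    rw [Pm]
    split_ifs with h
    · rw [← h, invDensity_zero]
    · exact (invDensity_pos hw.1 y).le
  | succ n ih =>
    have h := hasSum_invDensity_mul_Pker hw y
    have hle : ∀ z, Pm w n 0 z * Pker w z y ≤ invDensity w z * Pker w z y := fun z =>
      mul_le_mul_of_nonneg_right (ih z) (Pker_nonneg hw.1 z y)
    rw [Pm, ← h.tsum_eq]
    exact Summable.tsum_le_tsum hle (Summable.of_nonneg_of_le
      (fun z => mul_nonneg (Pm_nonneg hw.1 n 0 z) (Pker_nonneg hw.1 z y)) hle h.summable)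
      h.summable

lemma summable_Pm_mul (hw : GoodWeight w) (n : ℕ) : Summable fun x : ℤ => Pm w n 0 x * x := by
  refine Summable.of_norm_bounded (summable_abs_mul_invDensity hw) fun x => ?_
  rw [norm_mul, Real.norm_of_nonneg (Pm_nonneg hw.1 n 0 x), Real.norm_eq_abs, mul_comm]
  exact mul_le_mul_of_nonneg_left (Pm_zero_le_invDensity hw n x) (abs_nonneg _)

/-- The mean of the `n`-step distribution from `0` converges to the mean of the invariant
distribution. -/
lemma tendsto_mean (hw : GoodWeight w) :
    Tendsto (fun n => ∑' x : ℤ, Pm w n 0 x * x) atTop (nhds (-(1 / 2))) := by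
  set r := invDensity w with hr
  have hr0 : ∀ x, 0 < r x := invDensity_pos hw.1
  have hrs : Summable r := summable_invDensity hw
  set Z := ∑' x, r x with hZ
  have hZ1 : 1 ≤ Z := by
    have h := hrs.le_tsum 0 fun x _ => (hr0 x).le
    rwa [hr, invDensity_zero] at h
  have hZ0 : 0 < Z := one_pos.trans_le hZ1
  set ν : ℕ → ℤ → ℝ := fun n x => Pm w n 0 x - r x / Z with hν
  have hle : ∀ x, r x / Z ≤ r x := fun x => div_le_self (hr0 x).le hZ1
  have hνB : ∀ n x, |ν n x| ≤ r x := by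
    intro n x
    have h1 := Pm_nonneg hw.1 n 0 x
    have h2 := Pm_zero_le_invDensity hw n x
    have h3 : 0 < r x / Z := div_pos (hr0 x) hZ0
    rw [abs_le]
    constructor <;> simp only [hν] <;> linarith [hle x]
  have hPs : ∀ n, Summable (Pm w n 0) := fun n =>
    Summable.of_nonneg_of_le (Pm_nonneg hw.1 n 0) (Pm_zero_le_invDensity hw n) hrs
  have hstep : ∀ n y, ν (n + 1) y = ∑' x, ν n x * Pker w x y := by
    intro n y
    have h1 := (kernel_push (Pker_nonneg hw.1) (hasSum_Pker_row hw) (fun _ => le_rfl) (hPs n)).2.1 y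
    have h2 := (hasSum_invDensity_mul_Pker hw y).div_const Z
    simp only [hν]
    rw [Pm, ← h2.tsum_eq, ← h1.tsum_sub h2.summable]
    exact tsum_congr fun x => by simp only [hr]; ring
  have h0 : ∑' x, ν 0 x = 0 := by
    simp only [hν]
    rw [(hPs 0).tsum_sub (hrs.div_const Z), tsum_div_const, ← hZ, div_self hZ0.ne']
    simp [Pm]
  have hmeet : ∀ A : Finset ℤ, ∃ y₀, ∀ x ∈ A, 0 < Pker w x y₀ := by
    intro A
    obtain ⟨y₀, h⟩ := A.bddAbove
    exact ⟨y₀, fun x hx => Pker_pos hw.1 (by have : x ≤ y₀ := h hx; omega)⟩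
  have hTV := tendsto_totalVariation_zero (Pker_nonneg hw.1) (hasSum_Pker_row hw) hmeet hstep
    hrs hνB h0
  have hpt : ∀ x, Tendsto (fun n => ν n x * (x : ℝ)) atTop (nhds 0) := by
    intro x
    have h : Tendsto (fun n => ν n x) atTop (nhds 0) :=
      squeeze_zero_norm (fun n => (Summable.of_nonneg_of_le (fun _ => abs_nonneg _) (hνB n)
        hrs).le_tsum x fun _ _ => abs_nonneg _) hTV
    simpa using h.mul_const (x : ℝ)
  have hdom := tendsto_tsum_of_dominated_convergence (summable_abs_mul_invDensity hw) hpt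
    (Eventually.of_forall fun n x => by
      rw [norm_mul, Real.norm_eq_abs, Real.norm_eq_abs, mul_comm]
      exact mul_le_mul_of_nonneg_left (hνB n x) (abs_nonneg _))
  have hrx : Summable fun x : ℤ => r x / Z * x := by
    refine Summable.of_norm_bounded (summable_abs_mul_invDensity hw) fun x => ?_
    rw [norm_mul, Real.norm_of_nonneg (div_pos (hr0 x) hZ0).le, Real.norm_eq_abs, mul_comm]
    exact mul_le_mul_of_nonneg_left (hle x) (abs_nonneg _)
  have hmean : ∑' x : ℤ, r x / Z * x = -(1 / 2) := by
    have h : ∀ x : ℤ, r x / Z * x = r x * x / Z := fun x => by ring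
    rw [tsum_congr h, tsum_div_const, hr, tsum_invDensity_mul hw, ← hr, ← hZ,
      mul_div_cancel_right₀ _ hZ0.ne']
  have heq : ∀ n, ∑' x : ℤ, Pm w n 0 x * x = ∑' x : ℤ, ν n x * x + -(1 / 2) := by
    intro n
    have h : ∀ x : ℤ, ν n x * x = Pm w n 0 x * x - r x / Z * x := fun x => by
      simp only [hν]; ring
    rw [tsum_congr h, (summable_Pm_mul hw n).tsum_sub hrx, hmean]
    ring
  simpa only [heq, tsum_zero, zero_add] using hdom.add_const (-(1 / 2) : ℝ)

end Invariant

/-- for every `δ > 0` there is `n_δ` such that for all `n ≥ n_δ` the mean of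
the `n`-step distribution started at `0` exists and is at most `-1/(2+δ)`. -/
theorem stmt_10 (w : ℤ → ℝ) (hw : GoodWeight w) :
    ∀ δ > (0 : ℝ), ∃ nδ : ℕ, ∀ n ≥ nδ,
      Summable (fun x : ℤ => Pm w n 0 x * x) ∧
      ∑' x : ℤ, Pm w n 0 x * x ≤ -(1 / (2 + δ)) := by
  intro δ hδ
  have hlt : -(1 / 2 : ℝ) < -(1 / (2 + δ)) :=
    neg_lt_neg (one_div_lt_one_div_of_lt two_pos (by linarith))
  obtain ⟨N, hN⟩ := eventually_atTop.1 ((tendsto_order.1 (tendsto_mean hw)).2 _ hlt)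
  exact ⟨N, fun n hn => ⟨summable_Pm_mul hw n, (hN n hn).le⟩⟩
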